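/- Grünbaum's Lower Bound Theorem: let P be a d-polytope with d+s vertices, where 2 ≤ s ≤ d. Then for every 1 ≤ k ≤ d-1, the number of k-faces satisfies f_k(P) ≥ C(d+1, k+1) + C(d, k+1) - C(d+1-s, k+1). -/

import Mathlib

open Set

/-- `C n m` : binomial coefficient with the convention `C n m = 0` for `n < 0`. -/
def C (n : ℤ) (m : ℕ) : ℤ := if n < 0 then 0 else (n.toNat).choose m

/-- Grünbaum's lower bound function `φ_k(d+s, d)`. -/
def phi (d s k : ℕ) : ℤ := C (d + 1) (k + 1) + C d (k + 1) - C ((d : ℤ) + 1 - s) (k + 1)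

/-- A polytope: convex hull of a finite set of points. -/
def IsPolytope {N : ℕ} (P : Set (EuclideanSpace ℝ (Fin N))) : Prop :=
  ∃ V : Finset (EuclideanSpace ℝ (Fin N)), P = convexHull ℝ (V : Set (EuclideanSpace ℝ (Fin N)))

/-- The dimension of a set: the dimension of its affine span. -/
noncomputable def pdim {N : ℕ} (P : Set (EuclideanSpace ℝ (Fin N))) : ℕ :=
  Module.finrank ℝ (affineSpan ℝ P).direction

/-- `F` is a face of `P`: the intersection of `P` with a supporting hyperplane
(the linear functional may be zero, so `P` itself is a face; `F` may be empty). -/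
def IsFace {N : ℕ} (P F : Set (EuclideanSpace ℝ (Fin N))) : Prop :=
  ∃ (f : EuclideanSpace ℝ (Fin N) →ₗ[ℝ] ℝ) (c : ℝ),
    (∀ x ∈ P, f x ≤ c) ∧ F = {x ∈ P | f x = c}

/-- The set of vertices of `P` (points whose singleton is a face of `P`). -/
def vertexSet {N : ℕ} (P : Set (EuclideanSpace ℝ (Fin N))) : Set (EuclideanSpace ℝ (Fin N)) :=
  {v | IsFace P {v}}

/-- The number of (nonempty) `k`-dimensional faces of `P`. -/
noncomputable def fCount {N : ℕ} (P : Set (EuclideanSpace ℝ (Fin N))) (k : ℕ) : ℕ :=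
  {F : Set (EuclideanSpace ℝ (Fin N)) | IsFace P F ∧ F.Nonempty ∧ pdim F = k}.ncard

/-- `P` is a `k`-dimensional simplex. -/
def IsSimplex {N : ℕ} (P : Set (EuclideanSpace ℝ (Fin N))) (k : ℕ) : Prop :=
  ∃ V : Finset (EuclideanSpace ℝ (Fin N)), V.card = k + 1 ∧
    AffineIndependent ℝ (Subtype.val : {x // x ∈ V} → EuclideanSpace ℝ (Fin N)) ∧
    P = convexHull ℝ (V : Set (EuclideanSpace ℝ (Fin N)))

/-- `Q` is a pyramid over `P`. -/
def IsPyramid {N : ℕ} (Q P : Set (EuclideanSpace ℝ (Fin N))) : Prop :=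
  ∃ x, x ∉ affineSpan ℝ P ∧ Q = convexHull ℝ (insert x P)

/-- `Q` is an `r`-fold pyramid over `P`. -/
def IsFoldPyramid {N : ℕ} : ℕ → Set (EuclideanSpace ℝ (Fin N)) → Set (EuclideanSpace ℝ (Fin N)) → Prop
  | 0, Q, P => Q = P
  | (r + 1), Q, P => ∃ R, IsFoldPyramid r R P ∧ IsPyramid Q R

/-- `Q` is a bipyramid over `P`: the two apices span a segment whose interior
meets the relative interior of `P`. -/
def IsBipyramid {N : ℕ} (Q P : Set (EuclideanSpace ℝ (Fin N))) : Prop :=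
  ∃ x y, x ∉ affineSpan ℝ P ∧ y ∉ affineSpan ℝ P ∧
    (openSegment ℝ x y ∩ intrinsicInterior ℝ P).Nonempty ∧
    Q = convexHull ℝ (P ∪ {x, y})

/-- `Q` is the direct sum (free sum) of `P₁` and `P₂`: their affine spans meet in a single
point that is in the relative interior of each. -/
def IsDirectSum {N : ℕ} (Q P₁ P₂ : Set (EuclideanSpace ℝ (Fin N))) : Prop :=
  ∃ z, (affineSpan ℝ P₁ : Set (EuclideanSpace ℝ (Fin N))) ∩ (affineSpan ℝ P₂) = {z} ∧
    z ∈ intrinsicInterior ℝ P₁ ∧ z ∈ intrinsicInterior ℝ P₂ ∧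
    Q = convexHull ℝ (P₁ ∪ P₂)

/-- Combinatorial equivalence: an inclusion-preserving bijection between face lattices. -/
def CombEquiv {N M : ℕ} (P : Set (EuclideanSpace ℝ (Fin N))) (Q : Set (EuclideanSpace ℝ (Fin M))) : Prop :=
  Nonempty ({F : Set (EuclideanSpace ℝ (Fin N)) // IsFace P F} ≃o
    {G : Set (EuclideanSpace ℝ (Fin M)) // IsFace Q G})

/-- `P` is combinatorially dual to `Q`: its face lattice is that of `Q` reversed. -/
def DualCombEquiv {N M : ℕ} (P : Set (EuclideanSpace ℝ (Fin N))) (Q : Set (EuclideanSpace ℝ (Fin M))) : Prop :=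
  Nonempty ({F : Set (EuclideanSpace ℝ (Fin N)) // IsFace P F} ≃o
    ({G : Set (EuclideanSpace ℝ (Fin M)) // IsFace Q G})ᵒᵈ)

/-- `P` (of dimension `d`) is simplicial: all its facets are simplices. -/
def IsSimplicial {N : ℕ} (P : Set (EuclideanSpace ℝ (Fin N))) (d : ℕ) : Prop :=
  ∀ F, IsFace P F → F.Nonempty → pdim F = d - 1 → IsSimplex F (d - 1)

section Geometry

variable {N : ℕ} {P F G H : Set (EuclideanSpace ℝ (Fin N))}

theorem IsFace.subset (h : IsFace P F) : F ⊆ P := by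
  obtain ⟨f, c, -, rfl⟩ := h
  exact sep_subset _ _

theorem isFace_self (P : Set (EuclideanSpace ℝ (Fin N))) : IsFace P P :=
  ⟨0, 0, by simp, by simp⟩

theorem IsPolytope.convex (hP : IsPolytope P) : Convex ℝ P := by
  obtain ⟨V, rfl⟩ := hP
  exact convex_convexHull ℝ _

theorem IsFace.convex (h : IsFace P F) (hP : Convex ℝ P) : Convex ℝ F := by
  obtain ⟨f, c, -, rfl⟩ := h
  exact hP.inter (convex_hyperplane f.isLinear c)

/-- A face of the convex hull of a finite set is the convex hull of the points it contains. -/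
theorem IsFace.eq_convexHull {V : Finset (EuclideanSpace ℝ (Fin N))}
    (h : IsFace (convexHull ℝ (V : Set (EuclideanSpace ℝ (Fin N)))) F) :
    F = convexHull ℝ ((V : Set (EuclideanSpace ℝ (Fin N))) ∩ F) := by
  apply Subset.antisymm
  · obtain ⟨f, c, hf, rfl⟩ := h
    rintro x ⟨hx, hfx⟩
    obtain ⟨w, hw0, hw1, rfl⟩ := Finset.mem_convexHull'.1 hx
    have hV : ∀ y ∈ V, f y ≤ c := fun y hy => hf y (subset_convexHull ℝ _ hy)
    have hsum : ∑ y ∈ V, w y * (c - f y) = 0 := by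
      simp only [mul_sub, Finset.sum_sub_distrib, ← Finset.sum_mul, hw1, one_mul]
      rw [map_sum] at hfx
      simp only [map_smul, smul_eq_mul] at hfx
      linarith
    have hzero := (Finset.sum_eq_zero_iff_of_nonneg fun y hy =>
      mul_nonneg (hw0 y hy) (sub_nonneg.2 (hV y hy))).1 hsum
    classical
    have hne : ∀ y ∈ V, w y ≠ 0 → f y = c := fun y hy hwy => by
      have := (mul_eq_zero.1 (hzero y hy)).resolve_left hwy
      linarith
    rw [← Finset.sum_filter_of_ne (p := fun y => f y = c)
      (fun y hy h0 => hne y hy fun h => h0 (by simp [h]))]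
    refine (convex_convexHull ℝ _).sum_mem (fun y hy => hw0 y (Finset.mem_filter.1 hy).1) ?_ ?_
    · rw [Finset.sum_filter_of_ne hne, hw1]
    · intro y hy
      obtain ⟨hyV, hyc⟩ := Finset.mem_filter.1 hy
      exact subset_convexHull ℝ _ ⟨hyV, subset_convexHull ℝ _ hyV, hyc⟩
  · exact convexHull_min inter_subset_right (h.convex (convex_convexHull ℝ _))

theorem IsPolytope.finite_faces (hP : IsPolytope P) : {F | IsFace P F}.Finite := by
  obtain ⟨V, rfl⟩ := hP
  refine (V.finite_toSet.finite_subsets.image (convexHull ℝ)).subset fun F hF => ?_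
  exact ⟨_, inter_subset_left, (IsFace.eq_convexHull hF).symm⟩

theorem vertexSet_convexHull_subset {V : Finset (EuclideanSpace ℝ (Fin N))} :
    vertexSet (convexHull ℝ (V : Set (EuclideanSpace ℝ (Fin N)))) ⊆ V := by
  intro v hv
  by_contra hvV
  have h := IsFace.eq_convexHull hv
  rw [inter_singleton_eq_empty.2 hvV, convexHull_empty] at h
  exact singleton_ne_empty v h

theorem IsPolytope.finite_vertexSet (hP : IsPolytope P) : (vertexSet P).Finite := by
  obtain ⟨V, rfl⟩ := hP
  exact V.finite_toSet.subset vertexSet_convexHull_subset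

theorem IsPolytope.extremePoints_subset_vertexSet (hP : IsPolytope P) :
    P.extremePoints ℝ ⊆ vertexSet P := by
  obtain ⟨V, rfl⟩ := hP
  intro v hv
  have hvV : v ∈ V := extremePoints_convexHull_subset hv
  have hmem := ((convex_convexHull ℝ _).mem_extremePoints_iff_mem_sdiff_convexHull_sdiff.1 hv).2
  have hnot : v ∉ convexHull ℝ ((V : Set (EuclideanSpace ℝ (Fin N))) \ {v}) := fun h =>
    hmem (convexHull_mono (sdiff_subset_sdiff_left (subset_convexHull ℝ _)) h)
  obtain ⟨f, u, hfu, huv⟩ := geometric_hahn_banach_closed_point (convex_convexHull ℝ _)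
    ((V.finite_toSet.sdiff (t := {v})).isClosed_convexHull ℝ) hnot
  have hV : ∀ y ∈ V, y ≠ v → f y < f v := fun y hy hyv =>
    (hfu y (subset_convexHull ℝ _ ⟨hy, hyv⟩)).trans huv
  have hle : ∀ x ∈ convexHull ℝ (V : Set (EuclideanSpace ℝ (Fin N))), f x ≤ f v := by
    intro x hx
    refine convexHull_min (fun y hy => ?_) (convex_halfSpace_le f.toLinearMap.isLinear (f v)) hx
    by_cases hyv : y = v
    · simp [hyv]
    · exact (hV y hy hyv).le
  have hface : IsFace (convexHull ℝ (V : Set (EuclideanSpace ℝ (Fin N))))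
      {x ∈ convexHull ℝ (V : Set (EuclideanSpace ℝ (Fin N))) | f.toLinearMap x = f v} :=
    ⟨f.toLinearMap, f v, hle, rfl⟩
  have heq := hface.eq_convexHull
  have hinter : (V : Set (EuclideanSpace ℝ (Fin N))) ∩
      {x ∈ convexHull ℝ (V : Set (EuclideanSpace ℝ (Fin N))) | f.toLinearMap x = f v} = {v} := by
    ext y
    constructor
    · rintro ⟨hy, -, hyv⟩
      by_contra hne
      exact (hV y hy hne).ne hyv
    · rintro rfl
      exact ⟨hvV, subset_convexHull ℝ _ hvV, rfl⟩
  rw [hinter, convexHull_singleton] at heq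
  rwa [heq] at hface

theorem IsPolytope.convexHull_vertexSet (hP : IsPolytope P) : convexHull ℝ (vertexSet P) = P := by
  have hfin := hP.finite_vertexSet
  have hsub := hP.extremePoints_subset_vertexSet
  apply Subset.antisymm (convexHull_min (fun v (hv : IsFace P {v}) => hv.subset rfl) hP.convex)
  have hcomp : IsCompact P := by
    obtain ⟨V, rfl⟩ := hP
    exact V.finite_toSet.isCompact_convexHull ℝ
  refine (closure_convexHull_extremePoints hcomp hP.convex).symm.subset.trans ?_
  exact closure_minimal (convexHull_mono hsub) (hfin.isClosed_convexHull ℝ)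

/-- A face of a polytope is the convex hull of the vertices it contains. -/
theorem IsPolytope.convexHull_vertexSet_inter (hP : IsPolytope P) (hF : IsFace P F) :
    convexHull ℝ (vertexSet P ∩ F) = F := by
  obtain ⟨V, hV⟩ := hP.finite_vertexSet.exists_finset_coe
  have hF' : IsFace (convexHull ℝ (V : Set (EuclideanSpace ℝ (Fin N)))) F := by
    rwa [hV, hP.convexHull_vertexSet]
  rw [← hV]
  exact hF'.eq_convexHull.symm

/-- A face of a face of a polytope is a face. -/
theorem IsFace.trans (hP : IsPolytope P) (hF : IsFace P F) (hG : IsFace F G) : IsFace P G := by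
  have hGconv : Convex ℝ G := hG.convex (hF.convex hP.convex)
  obtain ⟨V, rfl⟩ := hP
  obtain ⟨f, c, hf, rfl⟩ := hF
  obtain ⟨g, d, hg, rfl⟩ := hG
  set P := convexHull ℝ (V : Set (EuclideanSpace ℝ (Fin N))) with hPdef
  have hVP : ∀ v ∈ V, v ∈ P := fun v hv => subset_convexHull ℝ _ hv
  obtain ⟨M, hM⟩ : ∃ M : ℝ, ∀ v ∈ V, f v < c → g v - d < M * (c - f v) := by
    have : ∀ᶠ M : ℝ in Filter.atTop, ∀ v ∈ V, f v < c → g v - d < M * (c - f v) := by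
      refine (Filter.eventually_all_finset V).2 fun v _ => ?_
      filter_upwards [Filter.eventually_gt_atTop ((g v - d) / (c - f v))] with M hM hv
      exact (div_lt_iff₀ (sub_pos.2 hv)).1 hM
    exact this.exists
  have hle : ∀ x ∈ P, (g + M • f) x ≤ d + M * c := by
    intro x hx
    refine convexHull_min (fun v hv => ?_)
      (convex_halfSpace_le (g + M • f).isLinear (d + M * c)) hx
    rcases (hf v (hVP v hv)).lt_or_eq with h | h
    · have := hM v hv h
      simp only [LinearMap.add_apply, LinearMap.smul_apply, smul_eq_mul, mem_ofPred_eq]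
      linarith
    · have := hg v ⟨hVP v hv, h⟩
      simp only [LinearMap.add_apply, LinearMap.smul_apply, smul_eq_mul, mem_ofPred_eq, h]
      linarith
  have hface : IsFace P {x ∈ P | (g + M • f) x = d + M * c} := ⟨_, _, hle, rfl⟩
  convert hface using 1
  apply Subset.antisymm
  · rintro x ⟨⟨hx, hfx⟩, hgx⟩
    refine ⟨hx, ?_⟩
    simp [hfx, hgx]
  · rw [hface.eq_convexHull]
    refine convexHull_min ?_ hGconv
    rintro v ⟨hv, hvP, hve⟩
    simp only [LinearMap.add_apply, LinearMap.smul_apply, smul_eq_mul] at hve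
    have hfv : f v = c := by
      refine (hf v hvP).eq_of_not_lt fun h => ?_
      have := hM v hv h
      linarith
    refine ⟨⟨hvP, hfv⟩, ?_⟩
    rw [hfv] at hve
    linarith

theorem pdim_lt_of_ssubset (hG : IsFace P G) (hF : F ⊆ P) (hGF : G ⊂ F) (hne : G.Nonempty) :
    pdim G < pdim F := by
  obtain ⟨f, c, hf, rfl⟩ := hG
  refine Submodule.finrank_lt_finrank_of_lt
    (AffineSubspace.direction_lt_of_nonempty (lt_of_le_of_ne (affineSpan_mono ℝ hGF.1) ?_) ?_)
  · intro heq
    obtain ⟨x, hxF, hxG⟩ := exists_of_ssubset hGF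
    have hx : x ∈ affineSpan ℝ {x ∈ P | f x = c} := heq ▸ subset_affineSpan ℝ _ hxF
    have hle : affineSpan ℝ {x ∈ P | f x = c} ≤
        (AffineSubspace.mk' c ⊥).comap f.toAffineMap := by
      refine affineSpan_le.2 fun y hy => ?_
      simp [AffineSubspace.mem_mk', hy.2]
    have := hle hx
    simp only [AffineSubspace.mem_comap, AffineSubspace.mem_mk', vsub_eq_sub, Submodule.mem_bot,
      LinearMap.coe_toAffineMap, sub_eq_zero] at this
    exact hxG ⟨hF hxF, this⟩
  · exact hne.mono (subset_affineSpan ℝ _)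

theorem pdim_singleton (v : EuclideanSpace ℝ (Fin N)) :
    pdim ({v} : Set (EuclideanSpace ℝ (Fin N))) = 0 := by
  simp [pdim, direction_affineSpan]

/-- If `G` has codimension at least two in `F`, then it can be enlarged to a face of `F`
avoiding a prescribed point. -/
theorem IsPolytope.exists_face_ssuperset (hP : IsPolytope P) (hF : IsFace P F) (hG : IsFace P G)
    (hGF : G ⊆ F) (hne : G.Nonempty) {x : EuclideanSpace ℝ (Fin N)} (hxF : x ∈ F) (hxG : x ∉ G)
    (hdim : pdim G + 1 < pdim F) : ∃ G', IsFace P G' ∧ G ⊂ G' ∧ G' ⊆ F ∧ x ∉ G' := by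
  obtain ⟨g, hg⟩ := hne
  set D := (affineSpan ℝ G).direction ⊔ Submodule.span ℝ {x - g} with hD
  have hDdim : Module.finrank ℝ D ≤ pdim G + 1 := by
    refine (Submodule.finrank_add_le_finrank_add_finrank _ _).trans ?_
    exact Nat.add_le_add_left ((finrank_span_le_card {x - g}).trans (by simp)) _
  obtain ⟨w, ⟨hwV, hwF⟩, hwD⟩ : ∃ w ∈ vertexSet P ∩ F, w - g ∉ D := by
    by_contra! hall
    have hle : affineSpan ℝ F ≤ AffineSubspace.mk' g D := by
      rw [← hP.convexHull_vertexSet_inter hF, affineSpan_convexHull]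
      exact affineSpan_le.2 fun w hw => AffineSubspace.mem_mk'.2 (hall w hw)
    have := Submodule.finrank_mono (AffineSubspace.direction_le hle)
    rw [AffineSubspace.direction_mk'] at this
    exact absurd (this.trans hDdim) (not_le.2 hdim)
  obtain ⟨b, hbw, hbD⟩ : ∃ b : EuclideanSpace ℝ (Fin N) →ₗ[ℝ] ℝ, 0 < b (w - g) ∧ D ≤ b.ker := by
    obtain ⟨b, hb, hbD⟩ := Submodule.exists_le_ker_of_notMem hwD
    rcases hb.lt_or_gt with h | h
    · refine ⟨-b, by simpa using h, fun y hy => ?_⟩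
      simpa using hbD hy
    · exact ⟨b, h, hbD⟩
  have hbx : b (x - g) = 0 :=
    hbD (Submodule.mem_sup_right (Submodule.mem_span_singleton_self _))
  have hbG : ∀ y ∈ G, b (y - g) = 0 := fun y hy => hbD (Submodule.mem_sup_left
    (AffineSubspace.vsub_mem_direction (subset_affineSpan ℝ _ hy) (subset_affineSpan ℝ _ hg)))
  obtain ⟨f, c, hf, rfl⟩ := id hG
  have hfin : {v ∈ vertexSet P ∩ F | 0 < b (v - g)}.Finite :=
    hP.finite_vertexSet.subset fun v hv => hv.1.1
  obtain ⟨u, ⟨⟨huV, huF⟩, hu⟩, hmin⟩ := exists_min_image _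
    (fun v => (c - f v) / b (v - g)) hfin ⟨w, ⟨hwV, hwF⟩, hbw⟩
  set t := (c - f u) / b (u - g) with ht
  have ht0 : 0 ≤ t := div_nonneg (sub_nonneg.2 (hf u (hF.subset huF))) hu.le
  have hface : IsFace F {y ∈ F | (f + t • b) y = c + t * b g} := by
    refine ⟨_, _, fun y hy => ?_, rfl⟩
    rw [← hP.convexHull_vertexSet_inter hF] at hy
    refine convexHull_min (fun v hv => ?_)
      (convex_halfSpace_le (f + t • b).isLinear (c + t * b g)) hy
    have hfv := hf v (hF.subset hv.2)
    have hkey : t * b (v - g) ≤ c - f v := by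
      rcases lt_or_ge 0 (b (v - g)) with h | h
      · exact (le_div_iff₀ h).1 (hmin v ⟨hv, h⟩)
      · nlinarith [mul_nonneg ht0 (neg_nonneg.2 h)]
    rw [map_sub] at hkey
    simp only [mem_ofPred_eq, LinearMap.add_apply, LinearMap.smul_apply, smul_eq_mul]
    linarith
  have hmem : ∀ y, (f + t • b) y = c + t * b g ↔ t * b (y - g) = c - f y := by
    intro y
    simp only [LinearMap.add_apply, LinearMap.smul_apply, smul_eq_mul, map_sub]
    constructor <;> intro h <;> linarith
  refine ⟨_, hF.trans hP hface, ⟨fun y hy => ⟨hGF hy, (hmem y).2 ?_⟩, fun h => ?_⟩,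
    sep_subset _ _, fun hx => ?_⟩
  · rw [hbG y hy, hy.2]
    simp
  · have : u ∈ {y ∈ F | (f + t • b) y = c + t * b g} :=
      ⟨huF, (hmem u).2 (div_mul_cancel₀ _ hu.ne')⟩
    exact hu.ne' (hbG u (h this))
  · have h := (hmem x).1 hx.2
    rw [hbx, mul_zero] at h
    exact hxG ⟨hF.subset hxF, by linarith⟩

/-- Within a face `F`, every nonempty face `H` lies in a facet of `F` that avoids a given point of
`F` outside `H`. -/
theorem IsPolytope.exists_facet (hP : IsPolytope P) (hF : IsFace P F) (hH : IsFace P H)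
    (hHF : H ⊆ F) (hne : H.Nonempty) {x : EuclideanSpace ℝ (Fin N)} (hxF : x ∈ F) (hxH : x ∉ H) :
    ∃ G, IsFace P G ∧ H ⊆ G ∧ G ⊆ F ∧ x ∉ G ∧ pdim G + 1 = pdim F := by
  obtain ⟨G, hmax⟩ := Set.Finite.exists_maximal
    (hP.finite_faces.subset (sep_subset {G | IsFace P G} fun G => H ⊆ G ∧ G ⊆ F ∧ x ∉ G))
    ⟨H, hH, Subset.rfl, hHF, hxH⟩
  obtain ⟨hG, hHG, hGF, hxG⟩ := hmax.prop
  refine ⟨G, hG, hHG, hGF, hxG, ?_⟩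
  have hlt := pdim_lt_of_ssubset hG hF.subset ⟨hGF, fun h => hxG (h hxF)⟩ (hne.mono hHG)
  refine (Nat.succ_le_of_lt hlt).eq_of_not_lt fun hdim => ?_
  obtain ⟨G', hG', hGG', hG'F, hxG'⟩ :=
    hP.exists_face_ssuperset hF hG hGF (hne.mono hHG) hxF hxG hdim
  exact hGG'.2 (hmax.le_of_ge ⟨hG', hHG.trans hGG'.1, hG'F, hxG'⟩ hGG'.1)

/-- Every face of dimension `e` has more than `e` vertices. -/
theorem IsPolytope.pdim_lt_ncard (hP : IsPolytope P) (hF : IsFace P F) (hne : F.Nonempty) :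
    pdim F < (vertexSet P ∩ F).ncard := by
  have hfin : (vertexSet P ∩ F).Finite := hP.finite_vertexSet.inter_of_left _
  have hhull := hP.convexHull_vertexSet_inter hF
  have hpos : 0 < (vertexSet P ∩ F).ncard := by
    refine (ncard_pos hfin).2 ?_
    rw [← hhull] at hne
    exact convexHull_nonempty_iff.1 hne
  have hdim : pdim F = Module.finrank ℝ (vectorSpan ℝ (vertexSet P ∩ F)) := by
    rw [← direction_affineSpan, ← affineSpan_convexHull, hhull, pdim]
  have := hfin.fintype
  have hcard : Fintype.card ↥(vertexSet P ∩ F) = (vertexSet P ∩ F).ncard - 1 + 1 := by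
    rw [← Nat.card_eq_fintype_card, Nat.card_coe_set_eq]
    omega
  have := finrank_vectorSpan_range_le ℝ (Subtype.val : ↥(vertexSet P ∩ F) → _) hcard
  rw [Subtype.range_coe] at this
  omega

/-- A face with more than `pdim F + 1` vertices has a facet missing at least two of them. -/
theorem IsPolytope.exists_facet_two_le (hP : IsPolytope P) (hF : IsFace P F)
    (hcard : pdim F + 2 ≤ (vertexSet P ∩ F).ncard) :
    ∃ G, IsFace P G ∧ G.Nonempty ∧ G ⊆ F ∧ pdim G + 1 = pdim F ∧
      2 ≤ ((vertexSet P ∩ F) \ G).ncard := by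
  have hfin : (vertexSet P ∩ F).Finite := hP.finite_vertexSet.inter_of_left _
  obtain ⟨v, ⟨hvV, hvF⟩, hv⟩ : ∃ v ∈ vertexSet P ∩ F,
      v ∈ affineSpan ℝ ((vertexSet P ∩ F) \ {v}) := by
    obtain ⟨t, htS, htspan, htind⟩ := exists_affineIndependent ℝ _ (vertexSet P ∩ F)
    have htfin : t.Finite := hfin.subset htS
    have := htfin.fintype
    have hle := htind.card_le_finrank_succ
    rw [Subtype.range_coe, ← direction_affineSpan, htspan, ← affineSpan_convexHull,
      hP.convexHull_vertexSet_inter hF, ← Nat.card_eq_fintype_card, Nat.card_coe_set_eq] at hle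
    obtain ⟨v, hvS, hvt⟩ := exists_mem_notMem_of_ncard_lt_ncard
      (show t.ncard < (vertexSet P ∩ F).ncard by unfold pdim at hcard; omega) htfin
    have hsub : t ⊆ (vertexSet P ∩ F) \ {v} := subset_sdiff_singleton htS hvt
    exact ⟨v, hvS, affineSpan_mono ℝ hsub (htspan.symm ▸ subset_affineSpan ℝ _ hvS)⟩
  obtain ⟨w, ⟨hwV, hwF⟩, hwv⟩ := exists_ne_of_one_lt_ncard
    (show 1 < (vertexSet P ∩ F).ncard by omega) v
  obtain ⟨G, hG, hwG, hGF, hvG, hdim⟩ := hP.exists_facet hF hwV (singleton_subset_iff.2 hwF)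
    (singleton_nonempty w) hvF hwv.symm
  refine ⟨G, hG, (singleton_nonempty w).mono hwG, hGF, hdim, ?_⟩
  by_contra! hlt
  have hsub : (vertexSet P ∩ F) \ {v} ⊆ G := by
    intro y hy
    by_contra hyG
    exact hy.2 ((ncard_le_one (hfin.sdiff)).1 (Nat.le_of_lt_succ hlt) y ⟨hy.1, hyG⟩
      v ⟨⟨hvV, hvF⟩, hvG⟩)
  obtain ⟨f, c, hf, rfl⟩ := hG
  have hle : affineSpan ℝ ((vertexSet P ∩ F) \ {v}) ≤
      (AffineSubspace.mk' c ⊥).comap f.toAffineMap := by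
    refine affineSpan_le.2 fun y hy => ?_
    simp [AffineSubspace.mem_mk', (hsub hy).2]
  have := hle hv
  simp only [AffineSubspace.mem_comap, AffineSubspace.mem_mk', vsub_eq_sub, Submodule.mem_bot,
    LinearMap.coe_toAffineMap, sub_eq_zero] at this
  exact hvG ⟨hF.subset hvF, this⟩

end Geometry

section Counting

variable {N : ℕ} {P F G H : Set (EuclideanSpace ℝ (Fin N))}

/-- A proper nonempty subface `H` of `F` is covered by a face contained in `F`. -/
theorem IsPolytope.exists_cover (hP : IsPolytope P) (hF : IsFace P F) (hH : IsFace P H)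
    (hHF : H ⊆ F) (hne : H.Nonempty) {n : ℕ} (hdim : pdim F = pdim H + (n + 1)) :
    ∃ H', IsFace P H' ∧ H ⊆ H' ∧ H' ⊆ F ∧ pdim H' = pdim H + 1 := by
  induction n generalizing F with
  | zero => exact ⟨F, hF, hHF, Subset.rfl, hdim⟩
  | succ n ih =>
    obtain ⟨x, hxF, hxH⟩ : ∃ x ∈ F, x ∉ H := by
      by_contra! h
      rw [Subset.antisymm h hHF] at hdim
      omega
    obtain ⟨G, hG, hHG, hGF, -, hGdim⟩ := hP.exists_facet hF hH hHF hne hxF hxH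
    obtain ⟨H', hH', hHH', hH'G, hH'dim⟩ := ih hG hHG (by omega)
    exact ⟨H', hH', hHH', hH'G.trans hGF, hH'dim⟩

/-- An interval of length `n` in the face lattice has at least as many elements of each rank as
the Boolean lattice of rank `n`. -/
theorem IsPolytope.choose_le_ncard_interval (hP : IsPolytope P) (hF : IsFace P F) (hH : IsFace P H)
    (hHF : H ⊆ F) (hne : H.Nonempty) {n m : ℕ} (hdim : pdim F = pdim H + n) :
    n.choose m ≤ {K | IsFace P K ∧ H ⊆ K ∧ K ⊆ F ∧ pdim K = pdim H + m}.ncard := by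
  have hfin : ∀ p : Set (EuclideanSpace ℝ (Fin N)) → Prop, {K | IsFace P K ∧ p K}.Finite :=
    fun p => hP.finite_faces.subset (sep_subset _ _)
  induction n generalizing F H m with
  | zero =>
    cases m with
    | zero =>
      rw [Nat.choose_self, Nat.one_le_iff_ne_zero, ← Nat.pos_iff_ne_zero, ncard_pos (hfin _)]
      exact ⟨H, hH, Subset.rfl, hHF, rfl⟩
    | succ m => simp
  | succ n ih =>
    cases m with
    | zero =>
      rw [Nat.choose_zero_right, Nat.one_le_iff_ne_zero, ← Nat.pos_iff_ne_zero,
        ncard_pos (hfin _)]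
      exact ⟨H, hH, Subset.rfl, hHF, rfl⟩
    | succ m =>
      obtain ⟨H', hH', hHH', hH'F, hH'dim⟩ := hP.exists_cover hF hH hHF hne hdim
      obtain ⟨x, hxH', hxH⟩ : ∃ x ∈ H', x ∉ H := by
        by_contra! h
        rw [Subset.antisymm h hHH'] at hH'dim
        omega
      obtain ⟨G, hG, hHG, hGF, hxG, hGdim⟩ := hP.exists_facet hF hH hHF hne (hH'F hxH') hxH
      have h1 := ih hF hH' hH'F (hne.mono hHH') (m := m) (by omega)
      have h2 := ih hG hH hHG hne (m := m + 1) (by omega)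
      rw [Nat.choose_succ_succ]
      refine (Nat.add_le_add h1 h2).trans ?_
      rw [← ncard_union_eq ?_ (hfin _) (hfin _)]
      · refine ncard_le_ncard ?_ (hfin _)
        rintro K (⟨hK, hHK, hKF, hKdim⟩ | ⟨hK, hHK, hKG, hKdim⟩)
        · exact ⟨hK, hHH'.trans hHK, hKF, by omega⟩
        · exact ⟨hK, hHK, hKG.trans hGF, hKdim⟩
      · rw [disjoint_left]
        rintro K ⟨-, hHK, -⟩ ⟨-, -, hKG, -⟩
        exact hxG (hKG (hHK hxH'))

/-- Through every vertex of `F` there is a face of codimension at most `S.card` avoiding a given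
set `S` of other points. -/
theorem IsPolytope.exists_face_avoiding (hP : IsPolytope P) (hF : IsFace P F)
    {v : EuclideanSpace ℝ (Fin N)} (hv : v ∈ vertexSet P) (hvF : v ∈ F)
    (S : Finset (EuclideanSpace ℝ (Fin N))) (hvS : v ∉ S) :
    ∃ G, IsFace P G ∧ v ∈ G ∧ G ⊆ F ∧ (∀ u ∈ S, u ∉ G) ∧ pdim F ≤ pdim G + S.card := by
  classical
  induction S using Finset.induction_on with
  | empty => exact ⟨F, hF, hvF, Subset.rfl, by simp, by simp⟩
  | insert u S hu ih =>
    obtain ⟨hvu, hvS⟩ := not_or.1 (Finset.mem_insert.not.1 hvS)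
    obtain ⟨G, hG, hvG, hGF, hSG, hdim⟩ := ih hvS
    rw [Finset.card_insert_of_notMem hu]
    by_cases huG : u ∈ G
    · obtain ⟨K, hK, hvK, hKG, huK, hKdim⟩ := hP.exists_facet hG hv (singleton_subset_iff.2 hvG)
        (singleton_nonempty v) huG (Ne.symm hvu)
      refine ⟨K, hK, singleton_subset_iff.1 hvK, hKG.trans hGF, fun w hw => ?_, by omega⟩
      rcases Finset.mem_insert.1 hw with rfl | hw
      · exact huK
      · exact fun hwK => hSG w hw (hKG hwK)
    · refine ⟨G, hG, hvG, hGF, fun w hw => ?_, by omega⟩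
      rcases Finset.mem_insert.1 hw with rfl | hw
      · exact huG
      · exact hSG w hw

/-- Lower bound for the number of `k`-faces of `F` meeting a given set of vertices of `F`. -/
theorem IsPolytope.choose_le_ncard_meeting (hP : IsPolytope P) (hF : IsFace P F) (k : ℕ)
    (S : Finset (EuclideanSpace ℝ (Fin N))) (hS : (S : Set _) ⊆ vertexSet P ∩ F) :
    (pdim F + 1).choose (k + 1) ≤
      {K | IsFace P K ∧ (∃ v ∈ S, v ∈ K) ∧ K ⊆ F ∧ pdim K = k}.ncard +
        (pdim F + 1 - S.card).choose (k + 1) := by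
  classical
  have hfin : ∀ p : Set (EuclideanSpace ℝ (Fin N)) → Prop, {K | IsFace P K ∧ p K}.Finite :=
    fun p => hP.finite_faces.subset (sep_subset _ _)
  induction S using Finset.induction_on with
  | empty => simp
  | insert v S hv ih =>
    rw [Finset.coe_insert, insert_subset_iff] at hS
    obtain ⟨⟨hvP, hvF⟩, hS⟩ := hS
    refine (ih hS).trans ?_
    obtain ⟨G, hG, hvG, hGF, hSG, hdim⟩ := hP.exists_face_avoiding hF hvP hvF S hv
    have hcount : (pdim F - S.card).choose k ≤
        {K | IsFace P K ∧ {v} ⊆ K ∧ K ⊆ G ∧ pdim K = k}.ncard := by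
      have h := hP.choose_le_ncard_interval hG hvP (singleton_subset_iff.2 hvG)
        (singleton_nonempty v) (n := pdim G) (m := k) (by rw [pdim_singleton, zero_add])
      rw [pdim_singleton, zero_add] at h
      exact (Nat.choose_le_choose k (by omega)).trans h
    have hunion : {K | IsFace P K ∧ (∃ v ∈ S, v ∈ K) ∧ K ⊆ F ∧ pdim K = k}.ncard +
        {K | IsFace P K ∧ {v} ⊆ K ∧ K ⊆ G ∧ pdim K = k}.ncard ≤
        {K | IsFace P K ∧ (∃ u ∈ insert v S, u ∈ K) ∧ K ⊆ F ∧ pdim K = k}.ncard := by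
      rw [← ncard_union_eq ?_ (hfin _) (hfin _)]
      · refine ncard_le_ncard ?_ (hfin _)
        rintro K (⟨hK, ⟨u, hu, huK⟩, hKF, hKdim⟩ | ⟨hK, hvK, hKG, hKdim⟩)
        · exact ⟨hK, ⟨u, Finset.mem_insert_of_mem hu, huK⟩, hKF, hKdim⟩
        · exact ⟨hK, ⟨v, Finset.mem_insert_self _ _, hvK rfl⟩, hKG.trans hGF, hKdim⟩
      · rw [disjoint_left]
        rintro K ⟨-, ⟨u, hu, huK⟩, -⟩ ⟨-, -, hKG, -⟩
        exact hSG u hu (hKG huK)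
    have hpascal : (pdim F + 1 - S.card).choose (k + 1) ≤
        (pdim F - S.card).choose k + (pdim F + 1 - (insert v S).card).choose (k + 1) := by
      rw [Finset.card_insert_of_notMem hv, Nat.add_sub_add_right]
      rcases le_or_gt S.card (pdim F) with h | h
      · rw [Nat.sub_add_comm h, Nat.choose_succ_succ]
      · rw [Nat.sub_eq_zero_of_le h]
        simp
    omega

theorem Nat.choose_add_add_choose_le {b b' : ℕ} (h : b ≤ b') (r n : ℕ) :
    (b + r).choose n + b'.choose n ≤ (b' + r).choose n + b.choose n := by
  cases n with
  | zero => simp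
  | succ n =>
    induction r with
    | zero => simp [Nat.add_comm]
    | succ r ih =>
      have := Nat.choose_le_choose n (Nat.add_le_add_right h r)
      rw [← Nat.add_assoc, ← Nat.add_assoc, Nat.choose_succ_succ' (b + r),
        Nat.choose_succ_succ' (b' + r)]
      omega

/-- Grünbaum's bound for the faces of a polytope. -/
theorem IsPolytope.grunbaum_bound (hP : IsPolytope P) (hF : IsFace P F) {e s : ℕ} (k : ℕ)
    (hdim : pdim F = e) (hcard : (vertexSet P ∩ F).ncard = e + s) (hs : 1 ≤ s) (hse : s ≤ e) :
    (e + 1).choose (k + 1) + e.choose (k + 1) ≤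
      {K | IsFace P K ∧ K.Nonempty ∧ K ⊆ F ∧ pdim K = k}.ncard + (e + 1 - s).choose (k + 1) := by
  have hfin : ∀ p : Set (EuclideanSpace ℝ (Fin N)) → Prop, {K | IsFace P K ∧ p K}.Finite :=
    fun p => hP.finite_faces.subset (sep_subset _ _)
  have hVfin : (vertexSet P ∩ F).Finite := hP.finite_vertexSet.inter_of_left _
  induction e generalizing F s with
  | zero => omega
  | succ e ih =>
    rcases hs.eq_or_lt with rfl | hs
    · obtain ⟨S, hS⟩ := hVfin.exists_finset_coe
      have h := hP.choose_le_ncard_meeting hF k S hS.subset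
      rw [← hS, ncard_coe_finset] at hcard
      rw [hcard, hdim, Nat.sub_self, Nat.choose_zero_succ] at h
      have hle : {K | IsFace P K ∧ (∃ v ∈ S, v ∈ K) ∧ K ⊆ F ∧ pdim K = k}.ncard ≤
          {K | IsFace P K ∧ K.Nonempty ∧ K ⊆ F ∧ pdim K = k}.ncard :=
        ncard_le_ncard (fun K ⟨hK, ⟨v, _, hvK⟩, h⟩ => ⟨hK, ⟨v, hvK⟩, h⟩) (hfin _)
      rw [Nat.add_sub_cancel]
      omega
    · obtain ⟨G, hG, hGne, hGF, hGdim, htwo⟩ := hP.exists_facet_two_le hF (by omega)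
      obtain ⟨S, hS⟩ := (hVfin.sdiff (t := G)).exists_finset_coe
      have hlt := hP.pdim_lt_ncard hG hGne
      have hsplit : (vertexSet P ∩ G).ncard + S.card = e + 1 + s := by
        rw [← ncard_coe_finset, hS, ← hcard, ← ncard_inter_add_ncard_sdiff_eq_ncard _ G hVfin,
          inter_assoc, inter_eq_right.2 hGF]
      rw [← hS, ncard_coe_finset] at htwo
      obtain ⟨t, ht⟩ : ∃ t, (vertexSet P ∩ G).ncard = e + (t + 1) :=
        ⟨(vertexSet P ∩ G).ncard - e - 1, by omega⟩
      have h1 := ih hG (by omega) ht (by omega) (by omega) (hP.finite_vertexSet.inter_of_left _)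
      have h2 := hP.choose_le_ncard_meeting hF k S (hS.subset.trans sdiff_subset)
      have hunion : {K | IsFace P K ∧ K.Nonempty ∧ K ⊆ G ∧ pdim K = k}.ncard +
          {K | IsFace P K ∧ (∃ v ∈ S, v ∈ K) ∧ K ⊆ F ∧ pdim K = k}.ncard ≤
          {K | IsFace P K ∧ K.Nonempty ∧ K ⊆ F ∧ pdim K = k}.ncard := by
        rw [← ncard_union_eq ?_ (hfin _) (hfin _)]
        · refine ncard_le_ncard ?_ (hfin _)
          rintro K (⟨hK, hne, hKG, hKdim⟩ | ⟨hK, ⟨v, -, hvK⟩, hKF, hKdim⟩)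
          · exact ⟨hK, hne, hKG.trans hGF, hKdim⟩
          · exact ⟨hK, ⟨v, hvK⟩, hKF, hKdim⟩
        · rw [disjoint_left]
          rintro K ⟨-, -, hKG, -⟩ ⟨-, ⟨v, hv, hvK⟩, -⟩
          exact (hS.subset hv).2 (hKG hvK)
      have hconv := Nat.choose_add_add_choose_le (b := e + 1 + 1 - s) (b' := e - t)
        (by omega) t (k + 1)
      rw [hdim, show e + 1 + 1 - S.card = e + 1 + 1 - s + t by omega] at h2
      rw [Nat.sub_add_cancel (show t ≤ e by omega)] at hconv
      rw [Nat.add_sub_add_right] at h1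
      omega

end Counting

theorem C_natCast (n m : ℕ) : C n m = n.choose m := by
  simp [C]

theorem stmt7 {N : ℕ} (P : Set (EuclideanSpace ℝ (Fin N))) (d s k : ℕ)
    (hP : IsPolytope P) (hdim : pdim P = d)
    (hvert : (vertexSet P).ncard = d + s)
    (hs : 2 ≤ s) (hsd : s ≤ d) (hk1 : 1 ≤ k) (hk2 : k ≤ d - 1) :
    (fCount P k : ℤ) ≥ phi d s k := by
  have hV : vertexSet P ∩ P = vertexSet P :=
    inter_eq_left.2 fun v (hv : IsFace P {v}) => hv.subset rfl
  have h := hP.grunbaum_bound (isFace_self P) k hdim (by rw [hV, hvert]) (by omega) hsd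
  have hcount : {K | IsFace P K ∧ K.Nonempty ∧ K ⊆ P ∧ pdim K = k}.ncard = fCount P k := by
    unfold fCount
    congr 1
    ext K
    exact ⟨fun ⟨hK, hne, _, hKdim⟩ => ⟨hK, hne, hKdim⟩,
      fun ⟨hK, hne, hKdim⟩ => ⟨hK, hne, hK.subset, hKdim⟩⟩
  rw [hcount] at h
  have hcast : ((d : ℤ) + 1 - s) = ((d + 1 - s : ℕ) : ℤ) := by omega
  have hcast' : (d : ℤ) + 1 = ((d + 1 : ℕ) : ℤ) := by omega
  rw [phi, hcast, hcast', C_natCast, C_natCast, C_natCast]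
  omega
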